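/- arXiv:2004.04939 — 2 statements merged into one kernel-verified Lean document; each statement's English description precedes it below -/
import Mathlib

section
/- For each i ∈ I there exists a unique F-algebra endomorphism T_i' of K_t(A) such that for all j ∈ I and m ∈ ℤ: T_i'(y(j,m)) = y(j, m − δ_{ij}) if a(i,j) ≠ −1, and T_i'(y(j,m)) = (t^{1/2} y(i,m) y(j,m) − t^{−1/2} y(j,m) y(i,m)) / (t − t^{−1}) if a(i,j) = −1. -/
noncomputable section

/-- The base field `F = ℂ(s)`, rational functions over `ℂ` in one variable `s`. -/
abbrev F : Type := RatFunc ℂ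

/-- `t^{1/2} := s`. -/
def tHalf : F := RatFunc.X

/-- `t := s^2`. -/
def tq : F := RatFunc.X ^ 2

/-- `A = (a i j)` is the Cartan matrix of a finite-dimensional simply-laced simple Lie
algebra of type ADE: a symmetric positive-definite integer matrix with diagonal entries `2`
and off-diagonal entries in `{0, -1}`. -/
def IsCartanADE {I : Type} [Fintype I] (a : I → I → ℤ) : Prop :=
  (∀ i, a i i = 2) ∧ (∀ i j, a i j = a j i) ∧
    (∀ i j, i ≠ j → a i j = 0 ∨ a i j = -1) ∧
    Matrix.PosDef (Matrix.of fun i j : I => (a i j : ℝ))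

variable {I : Type} [Fintype I] [DecidableEq I]

/-- The generator `y(i,m)` of the free algebra. -/
def X (i : I) (m : ℤ) : FreeAlgebra F (I × ℤ) := FreeAlgebra.ι F (i, m)

/-- The defining relations (a), (b), (c) of the quantum Grothendieck ring `K_t(A)`:
(a) quantum Serre relations in each copy, (b) `t`-boson relations between adjacent
copies, (c) `t`-commutation relations between non-adjacent copies. -/
inductive KtRel (a : I → I → ℤ) :
    FreeAlgebra F (I × ℤ) → FreeAlgebra F (I × ℤ) → Prop
  | comm0 {i j : I} {m : ℤ} (h : a i j = 0) :
      KtRel a (X i m * X j m) (X j m * X i m)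
  | serre {i j : I} {m : ℤ} (h : a i j = -1) :
      KtRel a (X i m ^ 2 * X j m + X j m * X i m ^ 2)
        ((tq + tq⁻¹) • (X i m * X j m * X i m))
  | boson (i j : I) (m : ℤ) :
      KtRel a (X i m * X j (m + 1))
        ((tq ^ (a i j)) • (X j (m + 1) * X i m)
          + (if i = j then ((1 : F) - tq ^ 2) • (1 : FreeAlgebra F (I × ℤ)) else 0))
  | tcomm {i j : I} {m p : ℤ} (h : p > m + 1) :
      KtRel a (X i m * X j p)
        ((tq ^ ((((-1 : ℤˣ) ^ (p - m + 1) : ℤˣ) : ℤ) * a i j)) • (X j p * X i m))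

/-- The quantum Grothendieck ring `K_t(A)`. -/
abbrev Kt (a : I → I → ℤ) := RingQuot (KtRel a)

/-- The generators `y(i,m)` of `K_t(A)`. -/
def y (a : I → I → ℤ) (i : I) (m : ℤ) : Kt a :=
  RingQuot.mkAlgHom F (KtRel a) (X i m)

/-- `z(i; j, m) := (t^{1/2} y(j,m) y(i,m) − t^{−1/2} y(i,m) y(j,m)) / (t − t^{−1})`. -/
def z (a : I → I → ℤ) (i j : I) (m : ℤ) : Kt a :=
  (tq - tq⁻¹)⁻¹ • (tHalf • (y a j m * y a i m) - tHalf⁻¹ • (y a i m * y a j m))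

/-- `T` satisfies the defining formulas of the braid-group generator `T_i` on `K_t(A)`:
`T(y(j,m)) = y(j, m + δ_{ij})` if `a i j ≠ -1`, and
`T(y(j,m)) = (t^{1/2} y(j,m) y(i,m) − t^{−1/2} y(i,m) y(j,m)) / (t − t^{−1})`
if `a i j = -1`. -/
def TiFormula (a : I → I → ℤ) (i : I) (T : Kt a → Kt a) : Prop :=
  ∀ (j : I) (m : ℤ),
    T (y a j m) =
      if a i j = -1 then z a i j m else y a j (m + if i = j then 1 else 0)

/-- `T` satisfies the defining formulas of the inverse braid-group generator `T_i'`: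
`T(y(j,m)) = y(j, m − δ_{ij})` if `a i j ≠ -1`, and
`T(y(j,m)) = (t^{1/2} y(i,m) y(j,m) − t^{−1/2} y(j,m) y(i,m)) / (t − t^{−1})`
if `a i j = -1`. -/
def TiInvFormula (a : I → I → ℤ) (i : I) (T : Kt a → Kt a) : Prop :=
  ∀ (j : I) (m : ℤ),
    T (y a j m) =
      if a i j = -1 then
        (tq - tq⁻¹)⁻¹ • (tHalf • (y a i m * y a j m) - tHalf⁻¹ • (y a j m * y a i m))
      else y a j (m - if i = j then 1 else 0)

set_option linter.all false

section Generic

variable {K R : Type*} [Field K] [Ring R] [Algebra K R]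

/-- The `q`-bracket used for the braid action. -/
def zz (c s : K) (x u : R) : R := c • (s • (x * u) - s⁻¹ • (u * x))

/-- quantum Serre relation. -/
def Ser (s : K) (x u : R) : Prop :=
  x ^ 2 * u + u * x ^ 2 = (s ^ 2 + (s ^ 2)⁻¹) • (x * u * x)

/-- q-commutation. -/
def QC (t : K) (e : ℤ) (x u : R) : Prop := x * u = (t ^ e) • (u * x)

theorem QC.zz_right {t c s : K} (ht : t ≠ 0) {e f : ℤ} {w x u : R} (h1 : QC t e w x)
    (h2 : QC t f w u) : QC t (e + f) w (zz c s x u) := by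
  unfold QC zz at *
  have e1 : w * (x * u) = t ^ (e + f) • ((x * u) * w) := by
    rw [← mul_assoc, h1, smul_mul_assoc, mul_assoc, h2, mul_smul_comm, smul_smul, zpow_add₀ ht,
      mul_assoc]
  have e2 : w * (u * x) = t ^ (e + f) • ((u * x) * w) := by
    rw [← mul_assoc, h2, smul_mul_assoc, mul_assoc, h1, mul_smul_comm, smul_smul, zpow_add₀ ht,
      mul_assoc, mul_comm (t ^ e)]
  simp only [mul_smul_comm, mul_sub, e1, e2, smul_mul_assoc, sub_mul]
  module

theorem QC.zz_left {t c s : K} (ht : t ≠ 0) {e f : ℤ} {w x u : R} (h1 : QC t e x w)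
    (h2 : QC t f u w) : QC t (e + f) (zz c s x u) w := by
  unfold QC zz at *
  have e1 : (x * u) * w = t ^ (e + f) • (w * (x * u)) := by
    rw [mul_assoc, h2, mul_smul_comm, ← mul_assoc, h1, smul_mul_assoc, smul_smul, zpow_add₀ ht,
      mul_assoc, mul_comm (t ^ e)]
  have e2 : (u * x) * w = t ^ (e + f) • (w * (u * x)) := by
    rw [mul_assoc, h1, mul_smul_comm, ← mul_assoc, h2, smul_mul_assoc, smul_smul, zpow_add₀ ht,
      mul_assoc]
  simp only [mul_smul_comm, mul_sub, e1, e2, smul_mul_assoc, sub_mul]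
  module

theorem QC.congr_exp {t : K} {e f : ℤ} {x u : R} (h : QC t e x u) (hef : e = f) : QC t f x u :=
  hef ▸ h

/-- `z x = t⁻¹ x z`. -/
theorem zz_mul_x {s c : K} (hs : s ≠ 0) {x u : R} (h : Ser s x u) :
    zz c s x u * x = (s ^ 2)⁻¹ • (x * zz c s x u) := by
  unfold zz Ser at *
  simp only [pow_two x, mul_assoc] at h
  linear_combination (norm := skip) (-c * s⁻¹) • h
  simp only [smul_mul_assoc, mul_smul_comm, mul_sub, sub_mul, smul_sub, smul_add, smul_smul, mul_assoc]
  match_scalars <;> field_simp <;> ring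

/-- `u z = t⁻¹ z u`. -/
theorem u_mul_zz {s c : K} (hs : s ≠ 0) {x u : R} (h : Ser s u x) :
    u * zz c s x u = (s ^ 2)⁻¹ • (zz c s x u * u) := by
  unfold zz Ser at *
  simp only [pow_two u, mul_assoc] at h
  linear_combination (norm := skip) (-c * s⁻¹) • h
  simp only [smul_mul_assoc, mul_smul_comm, mul_sub, sub_mul, smul_sub, smul_add, smul_smul, mul_assoc]
  match_scalars <;> field_simp <;> ring

/-- two neighbours of `i` -/
theorem zz_comm {s c : K} (hs : s ≠ 0) (h4 : s ^ 4 + 1 ≠ 0) {x u v : R} (hu : Ser s x u)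
    (hv : Ser s x v) (huv : u * v = v * u) :
    zz c s x u * zz c s x v = zz c s x v * zz c s x u := by
  unfold zz Ser at *
  simp only [pow_two x, mul_assoc] at hu hv
  have e1 := congrArg (· * v) hu
  have e2 := congrArg (v * ·) hu
  have e3 := congrArg (· * u) hv
  have e4 := congrArg (u * ·) hv
  have huv' : ∀ w, u * (v * w) = v * (u * w) := fun w => by rw [← mul_assoc, huv, mul_assoc]
  linear_combination (norm := skip) (-c ^ 2 * s ^ 4 / (s ^ 4 + 1)) • e1 +
    (c ^ 2 / (s ^ 4 + 1)) • e2 + (c ^ 2 * s ^ 4 / (s ^ 4 + 1)) • e3 - (c ^ 2 / (s ^ 4 + 1)) • e4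
  simp only [smul_mul_assoc, mul_smul_comm, mul_sub, sub_mul, mul_add, add_mul, smul_sub, smul_add,
    smul_smul, mul_assoc, huv, huv']
  match_scalars <;> field_simp <;> ring

theorem ser_v_zz {s c : K} {x u v : R} (h : Ser s v u) (hxv : v * x = x * v) :
    Ser s v (zz c s x u) := by
  unfold zz Ser at *
  simp only [pow_two v, mul_assoc] at h ⊢
  have hxv' : ∀ w, v * (x * w) = x * (v * w) := fun w => by rw [← mul_assoc, hxv, mul_assoc]
  have e1 := congrArg (x * ·) h
  have e2 := congrArg (· * x) h
  linear_combination (norm := skip) (c * s) • e1 - (c * s⁻¹) • e2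
  simp only [smul_mul_assoc, mul_smul_comm, mul_sub, sub_mul, mul_add, add_mul, smul_sub, smul_add,
    smul_smul, mul_assoc, hxv, hxv']
  module

theorem ser_zz_v {s c : K} (hs : s ≠ 0) (h4 : s ^ 4 + 1 ≠ 0) {x u v : R} (hu : Ser s x u)
    (hv : Ser s u v) (hxv : v * x = x * v) :
    Ser s (zz c s x u) v := by
  unfold zz Ser at *
  simp only [pow_two, mul_assoc] at hu hv ⊢
  have hxv' : ∀ w, v * (x * w) = x * (v * w) := fun w => by rw [← mul_assoc, hxv, mul_assoc]
  have e1 := congrArg (· * (u * v)) hu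
  have e2 := congrArg (fun w => u * (w * v)) hu
  have e3 := congrArg (fun w => u * v * w) hu
  have e4 := congrArg (· * (v * u)) hu
  have e5 := congrArg (fun w => v * (w * u)) hu
  have e6 := congrArg (fun w => v * u * w) hu
  have e7 := congrArg (· * (x * x)) hv
  have e8 := congrArg (fun w => x * (w * x)) hv
  have e9 := congrArg (fun w => x * x * w) hv
  linear_combination (norm := skip) (c ^ 2 * s ^ 2) •
    ((-(s ^ 2 / (s ^ 4 + 1))) • e1 - (1 / (s ^ 2 * (s ^ 4 + 1))) • e2 + (1 / s ^ 4) • e3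
    + e4 - (s ^ 2 / (s ^ 4 + 1)) • e5 - (1 / (s ^ 2 * (s ^ 4 + 1))) • e6
    + (1 / (s ^ 2 * (s ^ 4 + 1))) • e7 - (1 / s ^ 2) • e8 + (s ^ 2 / (s ^ 4 + 1)) • e9)
  simp only [smul_mul_assoc, mul_smul_comm, mul_sub, sub_mul, mul_add, add_mul, smul_sub, smul_add,
    smul_smul, mul_assoc, hxv, hxv']
  match_scalars <;> field_simp <;> ring

/-- `p = y(i,m-1)`, `x = y(i,m)`, `u = y(j,m)`. -/
theorem p_mul_zz {s c : K} (hs : s ≠ 0) (hc : c * (s ^ 2 - (s ^ 2)⁻¹) = 1) {p x u : R}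
    (hpx : p * x = (s ^ 2) ^ 2 • (x * p) + (1 - (s ^ 2) ^ 2) • (1 : R))
    (hpu : p * u = (s ^ 2)⁻¹ • (u * p)) :
    p * zz c s x u = s ^ 2 • (zz c s x u * p) + (s⁻¹ * (1 - (s ^ 2) ^ 2)) • u := by
  have hpx' : ∀ w, p * (x * w) = (s ^ 2) ^ 2 • (x * (p * w)) + (1 - (s ^ 2) ^ 2) • w := fun w => by
    rw [← mul_assoc, hpx]; simp [add_mul, mul_assoc]
  have hpu' : ∀ w, p * (u * w) = (s ^ 2)⁻¹ • (u * (p * w)) := fun w => by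
    rw [← mul_assoc, hpu]; simp [mul_assoc]
  unfold zz
  have hs2 : s⁻¹ * (1 - (s ^ 2) ^ 2) = c * (s - s⁻¹ * (s ^ 2)⁻¹) * (1 - (s ^ 2) ^ 2) := by
    have h0 : s⁻¹ * (c * (s ^ 2 - (s ^ 2)⁻¹)) = c * (s - s⁻¹ * (s ^ 2)⁻¹) := by field_simp
    rw [hc, mul_one] at h0
    exact congrArg (· * (1 - (s ^ 2) ^ 2)) h0
  rw [hs2]
  simp only [smul_mul_assoc, mul_smul_comm, mul_sub, sub_mul, mul_add, add_mul, smul_sub, smul_add,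
    smul_smul, mul_assoc, hpx, hpx', hpu, hpu', mul_one]
  match_scalars <;> field_simp <;> ring

theorem ser_p_zz {s c : K} (hs : s ≠ 0) (hc : c * (s ^ 2 - (s ^ 2)⁻¹) = 1) {p x u : R}
    (hpx : p * x = (s ^ 2) ^ 2 • (x * p) + (1 - (s ^ 2) ^ 2) • (1 : R))
    (hpu : p * u = (s ^ 2)⁻¹ • (u * p)) : Ser s p (zz c s x u) := by
  have h := p_mul_zz hs hc hpx hpu
  generalize zz c s x u = z at *
  have h' : ∀ w, p * (z * w) = s ^ 2 • (z * (p * w)) + (s⁻¹ * (1 - (s ^ 2) ^ 2)) • (u * w) :=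
    fun w => by rw [← mul_assoc, h]; simp [add_mul, mul_assoc]
  unfold Ser
  simp only [pow_two p, smul_mul_assoc, mul_smul_comm, mul_add, add_mul, smul_add,
    smul_smul, mul_assoc, h, h', hpu]
  match_scalars <;> field_simp <;> ring

theorem ser_zz_p {s c : K} (hs : s ≠ 0) (hc : c * (s ^ 2 - (s ^ 2)⁻¹) = 1) {p x u : R}
    (hpx : p * x = (s ^ 2) ^ 2 • (x * p) + (1 - (s ^ 2) ^ 2) • (1 : R))
    (hpu : p * u = (s ^ 2)⁻¹ • (u * p)) (hS : Ser s u x) : Ser s (zz c s x u) p := by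
  have h := p_mul_zz hs hc hpx hpu
  have h2 := u_mul_zz (c := c) hs hS
  generalize zz c s x u = z at *
  have h' : ∀ w, p * (z * w) = s ^ 2 • (z * (p * w)) + (s⁻¹ * (1 - (s ^ 2) ^ 2)) • (u * w) :=
    fun w => by rw [← mul_assoc, h]; simp [add_mul, mul_assoc]
  unfold Ser
  simp only [pow_two z, smul_mul_assoc, mul_smul_comm, mul_add, add_mul, smul_add,
    smul_smul, mul_assoc, h, h', h2]
  match_scalars <;> field_simp <;> ring

/-- `x,u` at level `m`, `X = y(i,m+1)`. -/
theorem zz_mul_X {s c : K} (hs : s ≠ 0) {x u X : R}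
    (hxX : x * X = (s ^ 2) ^ 2 • (X * x) + (1 - (s ^ 2) ^ 2) • (1 : R))
    (huX : u * X = (s ^ 2)⁻¹ • (X * u)) :
    zz c s x u * X = s ^ 2 • (X * zz c s x u) := by
  have hxX' : ∀ w, x * (X * w) = (s ^ 2) ^ 2 • (X * (x * w)) + (1 - (s ^ 2) ^ 2) • w := fun w => by
    rw [← mul_assoc, hxX]; simp [add_mul, mul_assoc]
  have huX' : ∀ w, u * (X * w) = (s ^ 2)⁻¹ • (X * (u * w)) := fun w => by
    rw [← mul_assoc, huX]; simp [mul_assoc]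
  unfold zz
  simp only [smul_mul_assoc, mul_smul_comm, mul_sub, sub_mul, mul_add, add_mul, smul_sub, smul_add,
    smul_smul, mul_assoc, hxX, hxX', huX, huX', mul_one]
  match_scalars <;> field_simp <;> ring

theorem zz_mul_U {s c : K} (hs : s ≠ 0) (hc : c * (s ^ 2 - (s ^ 2)⁻¹) = 1) {x u U : R}
    (huU : u * U = (s ^ 2) ^ 2 • (U * u) + (1 - (s ^ 2) ^ 2) • (1 : R))
    (hxU : x * U = (s ^ 2)⁻¹ • (U * x)) :
    zz c s x u * U = s ^ 2 • (U * zz c s x u) + (s⁻¹ * (1 - (s ^ 2) ^ 2)) • x := by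
  have huU' : ∀ w, u * (U * w) = (s ^ 2) ^ 2 • (U * (u * w)) + (1 - (s ^ 2) ^ 2) • w := fun w => by
    rw [← mul_assoc, huU]; simp [add_mul, mul_assoc]
  have hxU' : ∀ w, x * (U * w) = (s ^ 2)⁻¹ • (U * (x * w)) := fun w => by
    rw [← mul_assoc, hxU]; simp [mul_assoc]
  unfold zz
  have hs2 : s⁻¹ * (1 - (s ^ 2) ^ 2) = c * (s - s⁻¹ * (s ^ 2)⁻¹) * (1 - (s ^ 2) ^ 2) := by
    have h0 : s⁻¹ * (c * (s ^ 2 - (s ^ 2)⁻¹)) = c * (s - s⁻¹ * (s ^ 2)⁻¹) := by field_simp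
    rw [hc, mul_one] at h0
    exact congrArg (· * (1 - (s ^ 2) ^ 2)) h0
  rw [hs2]
  simp only [smul_mul_assoc, mul_smul_comm, mul_sub, sub_mul, mul_add, add_mul, smul_sub, smul_add,
    smul_smul, mul_assoc, huU, huU', hxU, hxU', mul_one]
  match_scalars <;> field_simp <;> ring

theorem zz_boson {s c : K} (hs : s ≠ 0) (hc : c * (s ^ 2 - (s ^ 2)⁻¹) = 1) {x u X U : R}
    (hxX : x * X = (s ^ 2) ^ 2 • (X * x) + (1 - (s ^ 2) ^ 2) • (1 : R))
    (huX : u * X = (s ^ 2)⁻¹ • (X * u))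
    (huU : u * U = (s ^ 2) ^ 2 • (U * u) + (1 - (s ^ 2) ^ 2) • (1 : R))
    (hxU : x * U = (s ^ 2)⁻¹ • (U * x)) :
    zz c s x u * zz c s X U =
      (s ^ 2) ^ 2 • (zz c s X U * zz c s x u) + (1 - (s ^ 2) ^ 2) • (1 : R) := by
  have h1 := zz_mul_X (c := c) hs hxX huX
  have h2 := zz_mul_U hs hc huU hxU
  generalize zz c s x u = z at *
  have h1' : ∀ w, z * (X * w) = s ^ 2 • (X * (z * w)) := fun w => by
    rw [← mul_assoc, h1]; simp [mul_assoc]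
  have h2' : ∀ w, z * (U * w) = s ^ 2 • (U * (z * w)) + (s⁻¹ * (1 - (s ^ 2) ^ 2)) • (x * w) :=
    fun w => by rw [← mul_assoc, h2]; simp [add_mul, mul_assoc]
  have hs2 : (1 - (s ^ 2) ^ 2) = c * (- (s ^ 2)⁻¹ * (1 - (s ^ 2) ^ 2) ^ 2) := by
    have : (1 - (s ^ 2) ^ 2) = (c * (s ^ 2 - (s ^ 2)⁻¹)) * (1 - (s ^ 2) ^ 2) := by rw [hc, one_mul]
    rw [this]
    have h3 : (c * (s ^ 2 - (s ^ 2)⁻¹)) * (1 - (s ^ 2) ^ 2) =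
      c * (- (s ^ 2)⁻¹ * (1 - (s ^ 2) ^ 2) ^ 2) := by field_simp; ring
    rw [hc] at h3 ⊢
    simpa using h3
  have h5 : (1 - (s ^ 2) ^ 2) • (1 : R) = (c * (- (s ^ 2)⁻¹ * (1 - (s ^ 2) ^ 2) ^ 2)) • (1 : R) := by
    rw [← hs2]
  rw [h5]
  unfold zz
  simp only [smul_mul_assoc, mul_smul_comm, mul_sub, sub_mul, mul_add, add_mul, smul_sub, smul_add,
    smul_smul, mul_assoc, h1, h1', h2, h2', hxX, mul_one]
  match_scalars <;> field_simp <;> ring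

end Generic

section Main

theorem tHalf_ne : tHalf ≠ 0 := RatFunc.X_ne_zero

theorem tq_eq : tq = tHalf ^ 2 := rfl

theorem tq_ne : tq ≠ 0 := pow_ne_zero 2 tHalf_ne

theorem tHalf_pow_ne (c : ℂ) : tHalf ^ 4 ≠ RatFunc.C c := by
  intro h
  have h1 : (algebraMap (Polynomial ℂ) F) (Polynomial.X ^ 4) =
      (algebraMap (Polynomial ℂ) F) (Polynomial.C c) := by
    rw [map_pow, RatFunc.algebraMap_X, RatFunc.algebraMap_C]; exact h
  have h2 := RatFunc.algebraMap_injective ℂ h1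
  have h3 := congrArg Polynomial.natDegree h2
  simp at h3

theorem h4 : tHalf ^ 4 + 1 ≠ 0 := by
  intro h
  apply tHalf_pow_ne (-1)
  rw [map_neg, map_one]
  linear_combination h

/-- the normalizing constant -/
def cc : F := (tq - tq⁻¹)⁻¹

theorem hcc : cc * (tHalf ^ 2 - (tHalf ^ 2)⁻¹) = 1 := by
  unfold cc
  rw [tq_eq]
  apply inv_mul_cancel₀
  intro h
  apply tHalf_pow_ne 1
  have hs := tHalf_ne
  rw [map_one]
  field_simp at h
  linear_combination h

theorem y_comm0 {a : I → I → ℤ} {i j : I} {m : ℤ} (h : a i j = 0) :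
    y a i m * y a j m = y a j m * y a i m := by
  have := RingQuot.mkAlgHom_rel F (KtRel.comm0 (m := m) h)
  simp only [map_mul] at this
  exact this

theorem y_serre {a : I → I → ℤ} {i j : I} {m : ℤ} (h : a i j = -1) :
    Ser tHalf (y a i m) (y a j m) := by
  have := RingQuot.mkAlgHom_rel F (KtRel.serre (m := m) h)
  simp only [map_mul, map_add, map_pow, map_smul] at this
  exact this

theorem y_boson {a : I → I → ℤ} {i : I} {m p : ℤ} (h : a i i = 2) (hp : p = m + 1) :
    y a i m * y a i p = (tHalf ^ 2) ^ 2 • (y a i p * y a i m) + (1 - (tHalf ^ 2) ^ 2) • 1 := by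
  subst hp
  have := RingQuot.mkAlgHom_rel F (KtRel.boson (a := a) i i m)
  simp only [map_mul, map_add, map_smul, map_one, if_true, h] at this
  exact this

theorem y_qc {a : I → I → ℤ} {i j : I} {m p : ℤ} (hmp : m < p) (h : i ≠ j ∨ p ≠ m + 1) :
    QC tq ((((-1 : ℤˣ) ^ (p - m + 1) : ℤˣ) : ℤ) * a i j) (y a i m) (y a j p) := by
  by_cases hp : p = m + 1
  · subst hp
    have hij : i ≠ j := by tauto
    have := RingQuot.mkAlgHom_rel F (KtRel.boson (a := a) i j m)
    simp only [map_mul, map_add, map_smul, if_neg hij, map_zero, add_zero] at this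
    have e : ((((-1 : ℤˣ) ^ (m + 1 - m + 1) : ℤˣ) : ℤ) * a i j) = a i j := by
      have : m + 1 - m + 1 = 2 := by ring
      rw [this]; simp
    rw [e]
    exact this
  · have := RingQuot.mkAlgHom_rel F (KtRel.tcomm (a := a) (i := i) (j := j) (m := m) (p := p)
      (by omega))
    simp only [map_mul, map_smul] at this
    exact this

theorem no_triangle {a : I → I → ℤ} (hA : IsCartanADE a) {i j k : I} (hij : a i j = -1)
    (hik : a i k = -1) (hjk : a j k = -1) : False := by
  obtain ⟨h2, hs, -, hp⟩ := hA
  have hne : ∀ {u v : I}, a u v = -1 → u ≠ v := by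
    intro u v h e
    subst e
    rw [h2] at h
    omega
  have := hne hij
  have := hne hik
  have := hne hjk
  have key := hp.dotProduct_mulVec_pos (x := Pi.single i (1 : ℝ) + Pi.single j 1 + Pi.single k 1) (by
    intro h
    have := congrFun h i
    simp_all)
  simp [Matrix.mulVec_add, dotProduct_add, add_dotProduct, h2, hij, hik, hjk, hs j i, hs k i, hs k j]
    at key
  norm_num at key

/-- The image of the generator. -/
def G (a : I → I → ℤ) (i j : I) (m : ℤ) : Kt a :=
  if a i j = -1 then zz cc tHalf (y a i m) (y a j m) else y a j (m - if i = j then 1 else 0)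

theorem G_self {a : I → I → ℤ} {i : I} (h : a i i = 2) (m : ℤ) : G a i i m = y a i (m - 1) := by
  simp [G, h]

theorem G_nb {a : I → I → ℤ} {i j : I} (h : a i j = -1) (m : ℤ) :
    G a i j m = zz cc tHalf (y a i m) (y a j m) := by
  simp [G, h]

theorem G_far {a : I → I → ℤ} {i j : I} (h : a i j = 0) (hij : i ≠ j) (m : ℤ) :
    G a i j m = y a j m := by
  simp [G, h, hij]

theorem qc_zero_iff {R : Type*} [Ring R] [Algebra F R] {x u : R} :
    QC tq 0 x u ↔ x * u = u * x := by
  simp [QC]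

theorem qc_one_iff {R : Type*} [Ring R] [Algebra F R] {x u : R} :
    QC tq 1 x u ↔ x * u = tHalf ^ 2 • (u * x) := by
  simp [QC, tq_eq]

theorem qc_neg_one_iff {R : Type*} [Ring R] [Algebra F R] {x u : R} :
    QC tq (-1) x u ↔ x * u = (tHalf ^ 2)⁻¹ • (u * x) := by
  rw [QC, tq_eq, zpow_neg_one]

theorem eps_succ (n : ℤ) : (((-1 : ℤˣ) ^ (n + 1) : ℤˣ) : ℤ) = - (((-1 : ℤˣ) ^ n : ℤˣ) : ℤ) := by
  rw [zpow_add]; simp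

theorem eps_two : (((-1 : ℤˣ) ^ (2 : ℤ) : ℤˣ) : ℤ) = 1 := by simp

theorem eps_three : (((-1 : ℤˣ) ^ (3 : ℤ) : ℤˣ) : ℤ) = -1 := by
  rw [show (3 : ℤ) = 2 + 1 by norm_num, eps_succ, eps_two]

theorem y_qc_succ {a : I → I → ℤ} {i j : I} {m p : ℤ} (hij : i ≠ j) (hp : p = m + 1) :
    QC tq (a i j) (y a i m) (y a j p) := by
  refine (y_qc (by omega) (Or.inl hij)).congr_exp ?_
  rw [show p - m + 1 = 2 by omega, eps_two, one_mul]

theorem cases3 {a : I → I → ℤ} (hA : IsCartanADE a) (i j : I) :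
    i = j ∨ (i ≠ j ∧ a i j = -1) ∨ (i ≠ j ∧ a i j = 0) := by
  by_cases h : i = j
  · exact Or.inl h
  · rcases hA.2.2.1 i j h with h' | h' <;> tauto

theorem G_qc {a : I → I → ℤ} (hA : IsCartanADE a) (i j k : I) {m p : ℤ} (hmp : m < p)
    (h : j ≠ k ∨ p ≠ m + 1) :
    QC tq ((((-1 : ℤˣ) ^ (p - m + 1) : ℤˣ) : ℤ) * a j k) (G a i j m) (G a i k p) := by
  have h2 := hA.1
  have hs := hA.2.1
  rcases cases3 hA i j with rfl | ⟨hij, hj⟩ | ⟨hij, hj⟩ <;>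
    rcases cases3 hA i k with rfl | ⟨hik, hk⟩ | ⟨hik, hk⟩
  · rw [G_self (h2 _), G_self (h2 _)]
    have hp : p ≠ m + 1 := by tauto
    refine (y_qc (by omega) (by right; omega)).congr_exp ?_
    rw [show p - 1 - (m - 1) + 1 = p - m + 1 by ring]
  · rw [G_self (h2 _), G_nb hk]
    refine (QC.zz_right tq_ne (y_qc (by omega) (by right; omega))
      (y_qc (by omega) (by right; omega))).congr_exp ?_
    rw [show p - (m - 1) + 1 = (p - m + 1) + 1 by ring, eps_succ, h2, hk]; ring
  · rw [G_self (h2 _), G_far hk hik]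
    refine (y_qc (by omega) (by right; omega)).congr_exp ?_
    rw [hk]; simp
  · rw [G_self (h2 _), G_nb hj, hs j i, hj]
    by_cases e1 : p = m + 1
    · subst e1
      have e : (m + 1 - m + 1 : ℤ) = 2 := by ring
      rw [e, eps_two, one_mul, qc_neg_one_iff, add_sub_cancel_right]
      exact zz_mul_x tHalf_ne (y_serre hj)
    by_cases e2 : p = m + 2
    · subst e2
      have e : (m + 2 - m + 1 : ℤ) = 3 := by ring
      rw [e, eps_three, neg_one_mul, neg_neg, qc_one_iff]
      refine zz_mul_X tHalf_ne (y_boson (h2 _) (by ring)) ?_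
      rw [← qc_neg_one_iff]
      exact (y_qc_succ hij.symm (by ring)).congr_exp (by rw [hs, hj])
    · refine (QC.zz_left tq_ne (y_qc (by omega) (by right; omega))
        (y_qc (by omega) (by right; omega))).congr_exp ?_
      rw [show p - m + 1 = (p - 1 - m + 1) + 1 by ring, eps_succ (p - 1 - m + 1), h2, hs j i, hj]; ring
  · rw [G_nb hj, G_nb hk]
    by_cases e1 : p = m + 1
    · have hjk : j ≠ k := by tauto
      have ajk : a j k = 0 := by
        rcases hA.2.2.1 j k hjk with h0 | h0
        · exact h0
        · exact (no_triangle hA hj hk h0).elim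
      have q1 : QC tq 1 (zz cc tHalf (y a i m) (y a j m)) (y a i p) := by
        rw [qc_one_iff]
        refine zz_mul_X tHalf_ne (y_boson (h2 _) e1) ?_
        rw [← qc_neg_one_iff]
        exact (y_qc_succ hij.symm e1).congr_exp (by rw [hs, hj])
      refine (QC.zz_right tq_ne q1 (QC.zz_left tq_ne (y_qc_succ hik e1)
        (y_qc_succ hjk e1))).congr_exp ?_
      rw [ajk, hk]; simp
    · refine (QC.zz_right tq_ne
        (QC.zz_left tq_ne (y_qc (by omega) (Or.inr e1)) (y_qc (by omega) (Or.inr e1)))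
        (QC.zz_left tq_ne (y_qc (by omega) (Or.inr e1)) (y_qc (by omega) (Or.inr e1)))).congr_exp ?_
      rw [h2, hs j i, hj, hk]; ring
  · rw [G_nb hj, G_far hk hik]
    refine (QC.zz_left tq_ne (y_qc hmp (Or.inl hik)) (y_qc hmp h)).congr_exp ?_
    rw [hk]; ring
  · rw [G_self (h2 _), G_far hj hij, hs j i, hj, mul_zero]
    by_cases e1 : p = m + 1
    · subst e1
      rw [qc_zero_iff, add_sub_cancel_right]
      exact y_comm0 (by rw [hs, hj])
    · refine (y_qc (by omega) (Or.inl hij.symm)).congr_exp ?_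
      rw [hs, hj, mul_zero]
  · rw [G_far hj hij, G_nb hk]
    refine (QC.zz_right tq_ne (y_qc hmp (Or.inl hij.symm)) (y_qc hmp h)).congr_exp ?_
    rw [hs j i, hj]; ring
  · rw [G_far hj hij, G_far hk hik]
    exact y_qc hmp h

theorem G_boson {a : I → I → ℤ} (hA : IsCartanADE a) (i j : I) (m : ℤ) :
    G a i j m * G a i j (m + 1) =
      (tHalf ^ 2) ^ 2 • (G a i j (m + 1) * G a i j m) + (1 - (tHalf ^ 2) ^ 2) • 1 := by
  have h2 := hA.1
  have hs := hA.2.1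
  rcases cases3 hA i j with rfl | ⟨hij, hj⟩ | ⟨hij, hj⟩
  · rw [G_self (h2 _), G_self (h2 _)]
    exact y_boson (h2 _) (by ring)
  · rw [G_nb hj, G_nb hj]
    refine zz_boson tHalf_ne hcc (y_boson (h2 _) rfl) ?_ (y_boson (h2 _) rfl) ?_
    · rw [← qc_neg_one_iff]
      exact (y_qc_succ hij.symm rfl).congr_exp (by rw [hs, hj])
    · rw [← qc_neg_one_iff]
      exact (y_qc_succ hij rfl).congr_exp (by rw [hj])
  · rw [G_far hj hij, G_far hj hij]
    exact y_boson (h2 _) rfl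

theorem G_comm0 {a : I → I → ℤ} (hA : IsCartanADE a) (i j k : I) (m : ℤ) (hjk : a j k = 0) :
    G a i j m * G a i k m = G a i k m * G a i j m := by
  have h2 := hA.1
  have hs := hA.2.1
  rcases cases3 hA i j with rfl | ⟨hij, hj⟩ | ⟨hij, hj⟩ <;>
    rcases cases3 hA i k with rfl | ⟨hik, hk⟩ | ⟨hik, hk⟩
  · rfl
  · omega
  · rw [G_self (h2 _), G_far hk hik, ← qc_zero_iff]
    exact (y_qc_succ hik (by ring)).congr_exp hk
  · rw [hs] at hjk; omega
  · rw [G_nb hj, G_nb hk]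
    exact zz_comm tHalf_ne h4 (y_serre hj) (y_serre hk) (y_comm0 hjk)
  · rw [G_nb hj, G_far hk hik, ← qc_zero_iff]
    exact QC.zz_left (e := 0) (f := 0) tq_ne (qc_zero_iff.2 (y_comm0 hk)) (qc_zero_iff.2 (y_comm0 hjk))
  · rw [G_self (h2 _), G_far hj hij, eq_comm, ← qc_zero_iff]
    exact (y_qc_succ hij (by ring)).congr_exp hj
  · rw [G_far hj hij, G_nb hk, ← qc_zero_iff]
    exact QC.zz_right (e := 0) (f := 0) tq_ne (qc_zero_iff.2 (y_comm0 (by rw [hs, hj])))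
      (qc_zero_iff.2 (y_comm0 hjk))
  · rw [G_far hj hij, G_far hk hik]
    exact y_comm0 hjk

theorem G_serre {a : I → I → ℤ} (hA : IsCartanADE a) (i j k : I) (m : ℤ) (hjk : a j k = -1) :
    Ser tHalf (G a i j m) (G a i k m) := by
  have h2 := hA.1
  have hs := hA.2.1
  rcases cases3 hA i j with rfl | ⟨hij, hj⟩ | ⟨hij, hj⟩ <;>
    rcases cases3 hA i k with rfl | ⟨hik, hk⟩ | ⟨hik, hk⟩
  · rw [h2] at hjk; omega
  · rw [G_self (h2 _), G_nb hk]
    refine ser_p_zz tHalf_ne hcc (y_boson (h2 _) (by ring)) ?_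
    rw [← qc_neg_one_iff]
    exact (y_qc_succ hik (by ring)).congr_exp hk
  · omega
  · rw [G_self (h2 _), G_nb hj]
    refine ser_zz_p tHalf_ne hcc (y_boson (h2 _) (by ring)) ?_ (y_serre hjk)
    rw [← qc_neg_one_iff]
    exact (y_qc_succ hij (by ring)).congr_exp hj
  · exact (no_triangle hA hj hk hjk).elim
  · rw [G_nb hj, G_far hk hik]
    exact ser_zz_v tHalf_ne h4 (y_serre hj) (y_serre hjk) (y_comm0 (by rw [hs, hk]))
  · rw [hs] at hjk; omega
  · rw [G_far hj hij, G_nb hk]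
    exact ser_v_zz (y_serre hjk) (y_comm0 (by rw [hs, hj]))
  · rw [G_far hj hij, G_far hk hik]
    exact y_serre hjk

theorem G_rel {a : I → I → ℤ} (hA : IsCartanADE a) (i : I) ⦃p q : FreeAlgebra F (I × ℤ)⦄
    (h : KtRel a p q) :
    FreeAlgebra.lift F (fun w : I × ℤ => G a i w.1 w.2) p =
      FreeAlgebra.lift F (fun w : I × ℤ => G a i w.1 w.2) q := by
  have hX : ∀ j m, FreeAlgebra.lift F (fun w : I × ℤ => G a i w.1 w.2) (X j m) = G a i j m :=
    fun j m => by simp [X]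
  cases h with
  | comm0 h =>
    simp only [map_mul, hX]
    exact G_comm0 hA i _ _ _ h
  | serre h =>
    simp only [map_mul, map_add, map_pow, map_smul, hX]
    exact G_serre hA i _ _ _ h
  | boson j k m =>
    by_cases hjk : j = k
    · subst hjk
      simp only [map_mul, map_add, map_smul, map_one, if_true, hX, hA.1]
      exact G_boson hA i j m
    · simp only [map_mul, map_add, map_smul, if_neg hjk, map_zero, add_zero, hX]
      refine (G_qc hA i j k (m := m) (p := m + 1) (by omega) (Or.inl hjk)).congr_exp ?_
      rw [show m + 1 - m + 1 = 2 by omega, eps_two, one_mul]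
  | tcomm h =>
    simp only [map_mul, map_smul, hX]
    exact G_qc hA i _ _ (by omega) (Or.inr (by omega))

end Main

/-- For each `i ∈ I` there exists a unique `F`-algebra endomorphism `T_i'` of
`K_t(A)` with `T_i'(y(j,m)) = y(j, m − δ_{ij})` if `a i j ≠ -1` and
`T_i'(y(j,m)) = (t^{1/2} y(i,m) y(j,m) − t^{−1/2} y(j,m) y(i,m)) / (t − t^{−1})`
if `a i j = -1`. -/
theorem statement1 {I : Type} [Fintype I] [DecidableEq I] (a : I → I → ℤ)
    (hA : IsCartanADE a) (i : I) :
    ∃! T : Kt a →ₐ[F] Kt a, TiInvFormula a i ⇑T := by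
  refine ⟨RingQuot.liftAlgHom F ⟨FreeAlgebra.lift F (fun w : I × ℤ => G a i w.1 w.2),
    G_rel hA i⟩, ?_, ?_⟩
  · intro j m
    rw [y, RingQuot.liftAlgHom_mkAlgHom_apply, X, FreeAlgebra.lift_ι_apply]
    rfl
  · intro T hT
    apply RingQuot.ringQuot_ext'
    apply FreeAlgebra.hom_ext
    funext w
    obtain ⟨j, m⟩ := w
    have h1 := hT j m
    simp only [Function.comp_apply, AlgHom.comp_apply, RingQuot.liftAlgHom_mkAlgHom_apply,
      FreeAlgebra.lift_ι_apply]
    exact h1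
end
end

section
/- Let i, j, k ∈ I with a(i,j) = a(i,k) = −1, j ≠ k and a(j,k) = 0, and let m ∈ ℤ. Then in K_t(A) the elements z(i; j,m) and z(i; k,m) commute: z(i; j,m) z(i; k,m) = z(i; k,m) z(i; j,m). -/
noncomputable section

variable {I : Type} [Fintype I] [DecidableEq I]

theorem alg_comm_aux {K R : Type*} [Field K] [Ring R] [Algebra K R] (s : K) (hs : s ≠ 0)
    (hc : s ^ 2 + (s ^ 2)⁻¹ ≠ 0) (x p q : R) (hpq : p * q = q * p)
    (hp : x ^ 2 * p + p * x ^ 2 = (s ^ 2 + (s ^ 2)⁻¹) • (x * p * x))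
    (hq : x ^ 2 * q + q * x ^ 2 = (s ^ 2 + (s ^ 2)⁻¹) • (x * q * x)) :
    (s • (p * x) - s⁻¹ • (x * p)) * (s • (q * x) - s⁻¹ • (x * q)) =
      (s • (q * x) - s⁻¹ • (x * q)) * (s • (p * x) - s⁻¹ • (x * p)) := by
  generalize hcdef : s ^ 2 + (s ^ 2)⁻¹ = c at *
  -- the two consequences of the Serre relations
  have h1 : c • (p * x * q * x - q * x * p * x) = p * x ^ 2 * q - q * x ^ 2 * p := by
    have e1 : p * (x ^ 2 * q + q * x ^ 2) = c • (p * x * q * x) := by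
      rw [hq, mul_smul_comm]; simp only [mul_assoc]
    have e2 : q * (x ^ 2 * p + p * x ^ 2) = c • (q * x * p * x) := by
      rw [hp, mul_smul_comm]; simp only [mul_assoc]
    rw [smul_sub, ← e1, ← e2, mul_add, mul_add, ← mul_assoc p q, ← mul_assoc q p, hpq,
      ← mul_assoc, ← mul_assoc]
    abel
  have h2 : c • (x * p * x * q - x * q * x * p) = p * x ^ 2 * q - q * x ^ 2 * p := by
    have e1 : (x ^ 2 * p + p * x ^ 2) * q = c • (x * p * x * q) := by
      rw [hp, smul_mul_assoc]
    have e2 : (x ^ 2 * q + q * x ^ 2) * p = c • (x * q * x * p) := by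
      rw [hq, smul_mul_assoc]
    rw [smul_sub, ← e1, ← e2, add_mul, add_mul, mul_assoc _ p q, mul_assoc _ q p, hpq]
    abel
  have hU : p * x * q * x - q * x * p * x = x * p * x * q - x * q * x * p :=
    smul_right_injective R hc (h1.trans h2.symm)
  have h3 : p * x ^ 2 * q - q * x ^ 2 * p = s ^ 2 • (p * x * q * x - q * x * p * x)
      + (s ^ 2)⁻¹ • (x * p * x * q - x * q * x * p) := by
    rw [← h1, ← hU, ← add_smul, hcdef]
  have hx : x * (p * (q * x)) = x * (q * (p * x)) := by
    rw [← mul_assoc p, hpq, mul_assoc]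
  rw [← sub_eq_zero]
  have h4 := sub_eq_zero.mpr h3
  rw [← neg_eq_zero] at h4
  rw [← h4]
  simp only [sub_mul, mul_sub, smul_mul_assoc, mul_smul_comm, smul_smul, smul_sub, mul_assoc, pow_two,
    mul_inv, inv_mul_cancel₀ hs, mul_inv_cancel₀ hs, one_smul, hx]
  abel

theorem tq_add_inv_ne : (RatFunc.X : F) ^ 2 + ((RatFunc.X : F) ^ 2)⁻¹ ≠ 0 := by
  have hX : (RatFunc.X : F) ≠ 0 := RatFunc.X_ne_zero
  intro h
  have h2 : (RatFunc.X : F) ^ 4 + 1 = 0 := by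
    have := congrArg (fun u => u * (RatFunc.X : F) ^ 2) h
    simp only [add_mul, zero_mul, inv_mul_cancel₀ (pow_ne_zero 2 hX)] at this
    rw [← this]; ring
  have h3 : algebraMap (Polynomial ℂ) F (Polynomial.X ^ 4 + 1) = algebraMap (Polynomial ℂ) F 0 := by
    simpa [RatFunc.algebraMap_X] using h2
  have h4 := RatFunc.algebraMap_injective ℂ h3
  have h5 := congrArg (Polynomial.eval 0) h4
  simp at h5

theorem y_serre_s11 {I : Type} [Fintype I] [DecidableEq I] (a : I → I → ℤ) (i j : I) (m : ℤ)
    (h : a i j = -1) :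
    y a i m ^ 2 * y a j m + y a j m * y a i m ^ 2 =
      ((RatFunc.X : F) ^ 2 + ((RatFunc.X : F) ^ 2)⁻¹) • (y a i m * y a j m * y a i m) := by
  have := RingQuot.mkAlgHom_rel F (KtRel.serre (a := a) (m := m) h)
  simp only [map_add, map_mul, map_pow, map_smul] at this
  exact this

theorem y_comm {I : Type} [Fintype I] [DecidableEq I] (a : I → I → ℤ) (i j : I) (m : ℤ)
    (h : a i j = 0) : y a i m * y a j m = y a j m * y a i m := by
  have := RingQuot.mkAlgHom_rel F (KtRel.comm0 (a := a) (m := m) h)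
  simp only [map_mul] at this
  exact this

/-- for `a i j = a i k = -1`, `j ≠ k`, `a j k = 0`, the elements
`z(i;j,m)` and `z(i;k,m)` commute. -/
theorem statement11 {I : Type} [Fintype I] [DecidableEq I] (a : I → I → ℤ)
    (hA : IsCartanADE a) (i j k : I) (hij : a i j = -1) (hik : a i k = -1)
    (hjk : j ≠ k) (hjk0 : a j k = 0) (m : ℤ) :
    z a i j m * z a i k m = z a i k m * z a i j m := by
  unfold z
  rw [smul_mul_smul_comm, smul_mul_smul_comm]
  congr 1
  exact alg_comm_aux (RatFunc.X : F) RatFunc.X_ne_zero tq_add_inv_ne _ _ _ (y_comm a j k m hjk0)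
    (y_serre_s11 a i j m hij) (y_serre_s11 a i k m hik)
end
end
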